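/- Let $0 < s < 1$, $1 \le p < \infty$ and $n \ge 2$. Then for every $y$ on the Euclidean unit sphere $\partial B \subset \mathbb{R}^n$, the quantity $J := \int_{1/2}^1 \int_{\partial B} \frac{(1-t)^p}{|x - t\, y|^{n+sp}}\, d\sigma(x)\, dt$ is finite. -/

import Mathlib

open MeasureTheory Metric

open scoped ENNReal RealInnerProductSpace

section StereographicChart

variable {E : Type*} [NormedAddCommGroup E] [InnerProductSpace ℝ E]

/-- Inverse stereographic projection onto the unit sphere, centred at `y` (the pole is `-y`). -/
noncomputable def stereoChart (y : E) (w : (ℝ ∙ y)ᗮ) : E :=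
  (4 + ‖w‖ ^ 2)⁻¹ • ((4 - ‖w‖ ^ 2) • y + (4 : ℝ) • (w : E))

lemma lipschitzWith_stereoChart {y : E} (hy : ‖y‖ = 1) : LipschitzWith 1 (stereoChart y) := by
  refine LipschitzWith.mk_one fun v w => ?_
  rw [dist_eq_norm, dist_eq_norm]
  refine le_of_sq_le_sq ?_ (norm_nonneg _)
  have hyv : ⟪y, (v : E)⟫ = 0 := Submodule.mem_orthogonal_singleton_iff_inner_right.1 v.2
  have hyw : ⟪y, (w : E)⟫ = 0 := Submodule.mem_orthogonal_singleton_iff_inner_right.1 w.2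
  have hvy : ⟪(v : E), y⟫ = 0 := by rw [real_inner_comm, hyv]
  have hwy : ⟪(w : E), y⟫ = 0 := by rw [real_inner_comm, hyw]
  have hvw : ‖v - w‖ ^ 2 = ‖v‖ ^ 2 - 2 * ⟪(v : E), (w : E)⟫ + ‖w‖ ^ 2 := by
    rw [norm_sub_sq_real, Submodule.coe_inner]
  have key : ‖stereoChart y v - stereoChart y w‖ ^ 2 =
      16 * ‖v - w‖ ^ 2 / ((4 + ‖v‖ ^ 2) * (4 + ‖w‖ ^ 2)) := by
    rw [hvw, ← real_inner_self_eq_norm_sq (stereoChart y v - stereoChart y w)]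
    simp only [stereoChart, inner_sub_left, inner_sub_right, inner_add_left, inner_add_right,
      inner_smul_left, inner_smul_right, hyv, hyw, hvy, hwy, real_inner_self_eq_norm_sq, hy,
      real_inner_comm (v : E) (w : E), Submodule.coe_norm, RCLike.conj_to_real]
    field_simp
    ring
  rw [key, div_le_iff₀ (by positivity)]
  nlinarith [sq_nonneg ‖v‖, sq_nonneg ‖w‖, sq_nonneg ‖v - w‖,
    mul_nonneg (sq_nonneg ‖v‖) (sq_nonneg ‖w‖),
    mul_nonneg (sq_nonneg ‖v - w‖) (sq_nonneg ‖v‖),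
    mul_nonneg (sq_nonneg ‖v - w‖) (sq_nonneg ‖w‖),
    mul_nonneg (sq_nonneg ‖v - w‖) (mul_nonneg (sq_nonneg ‖v‖) (sq_nonneg ‖w‖))]

lemma sphere_inter_closedBall_subset_image_stereoChart {y : E} (hy : ‖y‖ = 1) {r : ℝ}
    (hr0 : 0 ≤ r) (hr : r ≤ 3 / 2) :
    sphere (0 : E) 1 ∩ closedBall y r ⊆ stereoChart y '' closedBall 0 (2 * r) := by
  rintro x ⟨hx, hxr⟩
  rw [mem_sphere_zero_iff_norm] at hx
  rw [mem_closedBall, dist_eq_norm] at hxr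
  set c : ℝ := ⟪y, x⟫ with hc
  have hcx : ⟪x, y⟫ = c := real_inner_comm _ _
  have hdist : ‖x - y‖ ^ 2 = 2 - 2 * c := by
    rw [norm_sub_sq_real, hcx, hx, hy]; ring
  have hsq : ‖x - y‖ ^ 2 ≤ r ^ 2 := pow_le_pow_left₀ (norm_nonneg _) hxr 2
  have hc1 : -(1 / 8) ≤ c := by nlinarith
  have hc0 : 0 < 1 + c := by linarith
  have hmem : (2 / (1 + c)) • (x - c • y) ∈ (ℝ ∙ y)ᗮ := by
    rw [Submodule.mem_orthogonal_singleton_iff_inner_right, inner_smul_right, inner_sub_right,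
      inner_smul_right, real_inner_self_eq_norm_sq, hy, ← hc]
    ring
  have hnorm : ‖(2 / (1 + c)) • (x - c • y)‖ ^ 2 = 4 * (1 - c) / (1 + c) := by
    rw [norm_smul, mul_pow, norm_sub_sq_real, inner_smul_right, hcx, norm_smul, hx, hy,
      Real.norm_eq_abs, Real.norm_eq_abs, sq_abs, mul_pow, sq_abs]
    field_simp
    ring
  refine ⟨⟨_, hmem⟩, ?_, ?_⟩
  · rw [mem_closedBall_zero_iff, Submodule.coe_norm]
    refine le_of_sq_le_sq ?_ (by positivity)
    rw [hnorm, div_le_iff₀ hc0]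
    nlinarith [sq_nonneg r]
  · simp only [stereoChart, Submodule.coe_norm, hnorm]
    have h1 : 4 + 4 * (1 - c) / (1 + c) = 8 / (1 + c) := by field_simp; ring
    have h2 : 4 - 4 * (1 - c) / (1 + c) = 8 * c / (1 + c) := by field_simp; ring
    rw [h1, h2]
    match_scalars <;> field_simp <;> ring

lemma sphere_subset_closedBall_union {y : E} (hy : ‖y‖ = 1) :
    sphere (0 : E) 1 ⊆ closedBall y (3 / 2) ∪ closedBall (-y) (3 / 2) := by
  intro x hx
  rw [mem_sphere_zero_iff_norm] at hx
  have h1 : ‖x - y‖ ^ 2 = 2 - 2 * ⟪x, y⟫ := by rw [norm_sub_sq_real, hx, hy]; ring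
  have h2 : ‖x + y‖ ^ 2 = 2 + 2 * ⟪x, y⟫ := by rw [norm_add_sq_real, hx, hy]; ring
  rw [Set.mem_union, mem_closedBall, mem_closedBall, dist_eq_norm, dist_eq_norm, sub_neg_eq_add]
  rcases le_total 0 ⟪x, y⟫ with h | h
  · exact Or.inl (le_of_sq_le_sq (by linarith) (by norm_num))
  · exact Or.inr (le_of_sq_le_sq (by linarith) (by norm_num))

variable [FiniteDimensional ℝ E] [MeasurableSpace E] [BorelSpace E]

lemma exists_hausdorffMeasure_sphere_inter_closedBall_le_of_le {m : ℕ}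
    (hm : Module.finrank ℝ E = m + 1) {y : E} (hy : ‖y‖ = 1) :
    ∃ C : ℝ≥0∞, C ≠ ⊤ ∧ ∀ r : ℝ, 0 ≤ r → r ≤ 3 / 2 →
      μH[(m : ℝ)] (sphere (0 : E) 1 ∩ closedBall y r) ≤ C * ENNReal.ofReal (r ^ m) := by
  have hfin : Module.finrank ℝ (ℝ ∙ y)ᗮ = m := by
    have : Fact (Module.finrank ℝ E = m + 1) := ⟨hm⟩
    exact Submodule.finrank_orthogonal_span_singleton (by rintro rfl; simp at hy)
  have hHaar : (μH[(m : ℝ)] : Measure (ℝ ∙ y)ᗮ).IsAddHaarMeasure := by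
    rw [← hfin]; infer_instance
  refine ⟨ENNReal.ofReal (2 ^ m) * μH[(m : ℝ)] (ball (0 : (ℝ ∙ y)ᗮ) 1),
    ENNReal.mul_ne_top ENNReal.ofReal_ne_top measure_ball_lt_top.ne, fun r hr0 hr => ?_⟩
  calc μH[(m : ℝ)] (sphere (0 : E) 1 ∩ closedBall y r)
      ≤ μH[(m : ℝ)] (stereoChart y '' closedBall 0 (2 * r)) :=
        measure_mono (sphere_inter_closedBall_subset_image_stereoChart hy hr0 hr)
    _ ≤ μH[(m : ℝ)] (closedBall (0 : (ℝ ∙ y)ᗮ) (2 * r)) := by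
        simpa using (lipschitzWith_stereoChart hy).hausdorffMeasure_image_le
          (d := (m : ℝ)) (by positivity) (closedBall 0 (2 * r))
    _ = _ := by
        rw [Measure.addHaar_closedBall _ _ (by positivity), hfin, mul_pow,
          ENNReal.ofReal_mul (by positivity)]
        ring

/-- The surface measure of a spherical cap of radius `r` is at most a multiple of `r ^ m`, where
`m` is the dimension of the sphere. -/
lemma exists_hausdorffMeasure_sphere_inter_closedBall_le {m : ℕ}
    (hm : Module.finrank ℝ E = m + 1) {y : E} (hy : ‖y‖ = 1) :
    ∃ C : ℝ≥0∞, C ≠ ⊤ ∧ ∀ r : ℝ, 0 ≤ r →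
      μH[(m : ℝ)] (sphere (0 : E) 1 ∩ closedBall y r) ≤ C * ENNReal.ofReal (r ^ m) := by
  obtain ⟨C₁, hC₁, h₁⟩ := exists_hausdorffMeasure_sphere_inter_closedBall_le_of_le hm hy
  obtain ⟨C₂, hC₂, h₂⟩ := exists_hausdorffMeasure_sphere_inter_closedBall_le_of_le hm
    (y := -y) (by rwa [norm_neg])
  refine ⟨C₁ + C₂, ENNReal.add_ne_top.2 ⟨hC₁, hC₂⟩, fun r hr0 => ?_⟩
  rcases le_total r (3 / 2) with hr | hr
  · exact (h₁ r hr0 hr).trans (by gcongr; exact le_self_add)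
  · calc μH[(m : ℝ)] (sphere (0 : E) 1 ∩ closedBall y r)
        ≤ μH[(m : ℝ)] ((sphere (0 : E) 1 ∩ closedBall y (3 / 2)) ∪
            (sphere (0 : E) 1 ∩ closedBall (-y) (3 / 2))) := by
          refine measure_mono fun x hx => ?_
          rw [← Set.inter_union_distrib_left]
          exact ⟨hx.1, sphere_subset_closedBall_union hy hx.1⟩
      _ ≤ C₁ * ENNReal.ofReal ((3 / 2) ^ m) + C₂ * ENNReal.ofReal ((3 / 2) ^ m) :=
          (measure_union_le _ _).trans
            (add_le_add (h₁ _ (by norm_num) le_rfl) (h₂ _ (by norm_num) le_rfl))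
      _ ≤ (C₁ + C₂) * ENNReal.ofReal (r ^ m) := by
          rw [← add_mul]
          gcongr

end StereographicChart

section DyadicEstimate

/-- Dyadic bound of a kernel of order `-q` truncated at scale `ε`. -/
lemma ofReal_rpow_neg_le_tsum {ε ρ N q : ℝ} (hε : 0 < ε) (hq : 0 ≤ q) (hεN : ε ≤ N)
    (hρN : ρ ≤ 2 * N) :
    ENNReal.ofReal (N ^ (-q)) ≤
      ∑' k : ℕ, if ρ ≤ 2 ^ k * ε then ENNReal.ofReal ((2 ^ k * ε / 4) ^ (-q)) else 0 := by
  have hex : ∃ k : ℕ, ρ ≤ 2 ^ k * ε := by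
    obtain ⟨k, hk⟩ := pow_unbounded_of_one_lt (ρ / ε) (one_lt_two : (1 : ℝ) < 2)
    exact ⟨k, ((div_lt_iff₀ hε).1 hk).le⟩
  classical
  obtain ⟨k, hk, hmin⟩ : ∃ k : ℕ, ρ ≤ 2 ^ k * ε ∧ 2 ^ k * ε / 4 ≤ N := by
    refine ⟨Nat.find hex, Nat.find_spec hex, ?_⟩
    rcases h : Nat.find hex with _ | j
    · simp only [pow_zero, one_mul]; linarith
    · have := Nat.find_min hex (m := j) (by omega)
      rw [pow_succ]; linarith
  refine le_trans ?_ (ENNReal.le_tsum k)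
  rw [if_pos hk]
  exact ENNReal.ofReal_le_ofReal
    (Real.rpow_le_rpow_of_nonpos (by positivity) hmin (neg_nonpos.2 hq))

variable {E : Type*} [NormedAddCommGroup E] [NormedSpace ℝ E] [MeasurableSpace E] [BorelSpace E]

/-- A measure of growth `r ^ m` around the unit vector `y` integrates the kernel
`‖x - t • y‖ ^ (-q)` over the unit sphere to at most a multiple of `(1 - t) ^ (m - q)`. -/
lemma exists_lintegral_sphere_rpow_neg_le {m : ℕ} {q : ℝ} (hq : m < q) {μ : Measure E} {y : E}
    (hy : ‖y‖ = 1) {C : ℝ≥0∞} (hC : C ≠ ⊤)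
    (hμ : ∀ r : ℝ, 0 ≤ r → μ (sphere (0 : E) 1 ∩ closedBall y r) ≤ C * ENNReal.ofReal (r ^ m)) :
    ∃ K : ℝ≥0∞, K ≠ ⊤ ∧ ∀ t : ℝ, 0 ≤ t → t < 1 →
      ∫⁻ x in sphere (0 : E) 1, ENNReal.ofReal (‖x - t • y‖ ^ (-q)) ∂μ ≤
        K * ENNReal.ofReal ((1 - t) ^ (m - q)) := by
  set a : ℝ≥0∞ := ENNReal.ofReal (2 ^ (m - q)) with ha
  have ha1 : a < 1 := by
    rw [ha, ENNReal.ofReal_lt_one]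
    exact Real.rpow_lt_one_of_one_lt_of_neg one_lt_two (by linarith)
  refine ⟨C * ENNReal.ofReal (4 ^ q) * ∑' k : ℕ, a ^ k, ?_, fun t ht0 ht1 => ?_⟩
  · refine ENNReal.mul_ne_top (ENNReal.mul_ne_top hC ENNReal.ofReal_ne_top) ?_
    rw [ENNReal.tsum_geometric]
    exact ENNReal.inv_ne_top.2 (tsub_pos_of_lt ha1).ne'
  have hε : 0 < 1 - t := by linarith
  have hq0 : 0 ≤ q := (Nat.cast_nonneg m).trans hq.le
  have hty : ‖t • y‖ = t := by rw [norm_smul, hy, mul_one, Real.norm_of_nonneg ht0]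
  have hyty : ‖t • y - y‖ = 1 - t := by
    rw [show t • y - y = (t - 1) • y by module, norm_smul, hy, mul_one, Real.norm_eq_abs,
      abs_sub_comm, abs_of_pos hε]
  have hpt : ∀ x ∈ sphere (0 : E) 1, ENNReal.ofReal (‖x - t • y‖ ^ (-q)) ≤
      ∑' k : ℕ, (closedBall y (2 ^ k * (1 - t))).indicator
        (fun _ => ENNReal.ofReal ((2 ^ k * (1 - t) / 4) ^ (-q))) x := by
    intro x hx
    rw [mem_sphere_zero_iff_norm] at hx
    have h1 : 1 - t ≤ ‖x - t • y‖ := by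
      have := norm_sub_norm_le x (t • y)
      rwa [hx, hty] at this
    have h2 : ‖x - y‖ ≤ 2 * ‖x - t • y‖ := by
      have := norm_sub_le_norm_sub_add_norm_sub x (t • y) y
      rw [hyty] at this
      linarith
    refine (ofReal_rpow_neg_le_tsum hε hq0 h1 h2).trans (le_of_eq (tsum_congr fun k => ?_))
    classical
    simp only [Set.indicator_apply, mem_closedBall, dist_eq_norm]
  calc ∫⁻ x in sphere (0 : E) 1, ENNReal.ofReal (‖x - t • y‖ ^ (-q)) ∂μ
      ≤ ∫⁻ x in sphere (0 : E) 1, ∑' k : ℕ, (closedBall y (2 ^ k * (1 - t))).indicator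
        (fun _ => ENNReal.ofReal ((2 ^ k * (1 - t) / 4) ^ (-q))) x ∂μ :=
        setLIntegral_mono' isClosed_sphere.measurableSet hpt
    _ = ∑' k : ℕ, ENNReal.ofReal ((2 ^ k * (1 - t) / 4) ^ (-q)) *
          μ (sphere (0 : E) 1 ∩ closedBall y (2 ^ k * (1 - t))) := by
        rw [lintegral_tsum fun k =>
          (measurable_const.indicator isClosed_closedBall.measurableSet).aemeasurable]
        refine tsum_congr fun k => ?_
        rw [lintegral_indicator_const isClosed_closedBall.measurableSet,
          Measure.restrict_apply isClosed_closedBall.measurableSet, Set.inter_comm]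
    _ ≤ ∑' k : ℕ, (C * ENNReal.ofReal (4 ^ q) * ENNReal.ofReal ((1 - t) ^ (m - q))) * a ^ k := by
        refine ENNReal.tsum_le_tsum fun k => ?_
        have hR : 0 < 2 ^ k * (1 - t) := by positivity
        refine (mul_le_mul_right (hμ _ hR.le) _).trans (le_of_eq ?_)
        have hreal : (2 ^ k * (1 - t) / 4) ^ (-q) * (2 ^ k * (1 - t)) ^ m =
            4 ^ q * (1 - t) ^ (m - q) * (2 ^ (m - q)) ^ k := by
          rw [Real.div_rpow hR.le (by norm_num), Real.rpow_neg (by norm_num : (0 : ℝ) ≤ 4),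
            div_inv_eq_mul, mul_right_comm, ← Real.rpow_natCast (2 ^ k * (1 - t)) m,
            ← Real.rpow_add hR, neg_add_eq_sub, Real.mul_rpow (by positivity) hε.le,
            ← Real.rpow_natCast_mul two_pos.le, mul_comm (k : ℝ), Real.rpow_mul_natCast two_pos.le]
          ring
        calc _ = C * ENNReal.ofReal ((2 ^ k * (1 - t) / 4) ^ (-q) * (2 ^ k * (1 - t)) ^ m) := by
              rw [ENNReal.ofReal_mul (by positivity)]; ring
          _ = _ := by
              rw [hreal, ENNReal.ofReal_mul (by positivity), ENNReal.ofReal_mul (by positivity),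
                ha, ENNReal.ofReal_pow (by positivity)]
              ring
    _ = _ := by rw [ENNReal.tsum_mul_left]; ring

end DyadicEstimate

lemma setLIntegral_one_sub_rpow_lt_top {a : ℝ} (ha : -1 < a) :
    ∫⁻ t in Set.Icc (1 / 2 : ℝ) 1, ENNReal.ofReal ((1 - t) ^ a) < ⊤ := by
  have h : IntervalIntegrable (fun t : ℝ => (1 - t) ^ a) volume (1 / 2) 1 := by
    have := (intervalIntegral.intervalIntegrable_rpow' (a := 1 / 2) (b := 0) ha).comp_sub_left 1
    norm_num at this ⊢
    exact this
  rw [intervalIntegrable_iff_integrableOn_Icc_of_le (by norm_num)] at h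
  exact h.lintegral_lt_top

/-- finiteness of `J = ∫_{1/2}^1 ∫_{∂B} (1-t)^p / |x - t y|^{n+sp} dσ(x) dt`. -/
theorem J_integral_finite
    (n : ℕ) (hn : 2 ≤ n) (s p : ℝ) (hs0 : 0 < s) (hs1 : s < 1) (hp : 1 ≤ p) :
    ∀ y ∈ sphere (0 : EuclideanSpace ℝ (Fin n)) 1,
      (∫⁻ t in Set.Icc (1 / 2 : ℝ) 1,
        ∫⁻ x in sphere (0 : EuclideanSpace ℝ (Fin n)) 1,
          ENNReal.ofReal ((1 - t) ^ p / ‖x - t • y‖ ^ ((n : ℝ) + s * p))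
        ∂μH[(n : ℝ) - 1]) < ⊤ := by
  intro y hy
  rw [mem_sphere_zero_iff_norm] at hy
  obtain ⟨m, rfl⟩ : ∃ m, n = m + 1 := ⟨n - 1, by omega⟩
  have hdim : ((m + 1 : ℕ) : ℝ) - 1 = m := by push_cast; ring
  have hsp : 0 < s * p := by positivity
  rw [hdim]
  obtain ⟨C, hC, hcap⟩ := exists_hausdorffMeasure_sphere_inter_closedBall_le
    (E := EuclideanSpace ℝ (Fin (m + 1))) (m := m) (by simp) hy
  obtain ⟨K, hK, hker⟩ := exists_lintegral_sphere_rpow_neg_le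
    (q := ((m + 1 : ℕ) : ℝ) + s * p) (by push_cast; linarith) hy hC hcap
  have hexp : (m : ℝ) - (((m + 1 : ℕ) : ℝ) + s * p) = -1 - s * p := by push_cast; ring
  rw [hexp] at hker
  refine lt_of_le_of_lt (setLIntegral_mono' (g := fun t : ℝ =>
    K * ENNReal.ofReal ((1 - t) ^ (p - s * p - 1))) measurableSet_Icc fun t ht => ?_) ?_
  · rcases ht.2.lt_or_eq with ht1 | rfl
    · have hε : 0 < 1 - t := by linarith
      calc ∫⁻ x in sphere (0 : EuclideanSpace ℝ (Fin (m + 1))) 1,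
            ENNReal.ofReal ((1 - t) ^ p / ‖x - t • y‖ ^ (((m + 1 : ℕ) : ℝ) + s * p)) ∂μH[(m : ℝ)]
          = ENNReal.ofReal ((1 - t) ^ p) *
            ∫⁻ x in sphere (0 : EuclideanSpace ℝ (Fin (m + 1))) 1,
              ENNReal.ofReal (‖x - t • y‖ ^ (-(((m + 1 : ℕ) : ℝ) + s * p))) ∂μH[(m : ℝ)] := by
            rw [← lintegral_const_mul' _ _ ENNReal.ofReal_ne_top]
            refine lintegral_congr fun x => ?_
            rw [← ENNReal.ofReal_mul (by positivity), Real.rpow_neg (norm_nonneg _),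
              div_eq_mul_inv]
        _ ≤ ENNReal.ofReal ((1 - t) ^ p) * (K * ENNReal.ofReal ((1 - t) ^ (-1 - s * p))) := by
            gcongr
            exact hker t (by linarith [ht.1]) ht1
        _ = K * ENNReal.ofReal ((1 - t) ^ (p - s * p - 1)) := by
            rw [mul_left_comm, ← ENNReal.ofReal_mul (by positivity), ← Real.rpow_add hε]
            ring_nf
    · simp [Real.zero_rpow (by linarith : p ≠ 0)]
  · rw [lintegral_const_mul' _ _ hK]
    refine ENNReal.mul_lt_top hK.lt_top (setLIntegral_one_sub_rpow_lt_top ?_)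
    nlinarith
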